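/- Let u₀ be a probability density on ℝⁿ with finite second moment, and for t > 0 let u(·,t) = u₀ * M_{2t} be the solution of the heat equation with initial datum u₀. Then DeBruijn's identity holds: for every t > 0, d/dt H(u(·,t)) = I(u(·,t)). -/

import Mathlib

open MeasureTheory Real
open scoped RealInnerProductSpace

noncomputable section

/-- `ℝⁿ` as a Euclidean (inner product) space. -/
abbrev Euc (n : ℕ) := EuclideanSpace ℝ (Fin n)

/-- `f` is a probability density on `ℝⁿ`. -/
def IsProbDensity {n : ℕ} (f : Euc n → ℝ) : Prop :=
  Measurable f ∧ (∀ x, 0 ≤ f x) ∧ (∫ x, f x) = 1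

/-- Shannon entropy `H(f) = -∫ f log f`. -/
def shannonEntropy {n : ℕ} (f : Euc n → ℝ) : ℝ := -∫ x, f x * Real.log (f x)

/-- Shannon entropy power `N(f) = exp((2/n) H(f))`. -/
def entropyPower (n : ℕ) (f : Euc n → ℝ) : ℝ :=
  Real.exp ((2 / (n : ℝ)) * shannonEntropy f)

/-- Fisher information `I(f) = ∫_{f>0} |∇f|²/f`. -/
def fisherInfo {n : ℕ} (f : Euc n → ℝ) : ℝ :=
  ∫ x in {x | 0 < f x}, ‖gradient f x‖ ^ 2 / f x

/-- Second moment `E(f) = ∫ |x|² f(x) dx`. -/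
def secondMoment {n : ℕ} (f : Euc n → ℝ) : ℝ := ∫ x, ‖x‖ ^ 2 * f x

/-- The centered isotropic Gaussian density `M_σ` on `ℝⁿ`. -/
def gaussianDensity (n : ℕ) (σ : ℝ) : Euc n → ℝ :=
  fun x => (2 * π * σ) ^ (-(n : ℝ) / 2) * Real.exp (-‖x‖ ^ 2 / (2 * σ))

/-- `f` is a (translated isotropic) Gaussian density. -/
def IsGaussianDensity {n : ℕ} (f : Euc n → ℝ) : Prop :=
  ∃ (m : Euc n) (σ : ℝ), 0 < σ ∧ ∀ x, f x = gaussianDensity n σ (x - m)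

/-- The solution of the heat equation with initial datum `u₀`: the convolution
`u(·,t) = u₀ * M_{2t}`. -/
def heatSol {n : ℕ} (u₀ : Euc n → ℝ) (t : ℝ) : Euc n → ℝ :=
  fun x => ∫ y, u₀ y * gaussianDensity n (2 * t) (x - y)

/-- The convolution `u₀ * φ` on `ℝⁿ`. -/
def densityConv {n : ℕ} (u₀ φ : Euc n → ℝ) : Euc n → ℝ :=
  fun x => ∫ y, u₀ y * φ (x - y)

theorem integrable_exp_neg_mul_norm_sq {n : ℕ} {κ : ℝ} (hκ : 0 < κ) :
    Integrable (fun x : Euc n => Real.exp (-κ * ‖x‖ ^ 2)) := by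
  have h := GaussianFourier.integrable_cexp_neg_mul_sq_norm_add (V := Euc n)
    (b := (κ : ℂ)) (by simpa using hκ) 0 0
  refine h.norm.congr (Filter.Eventually.of_forall fun x => ?_)
  simp only [Complex.norm_exp]
  congr 1
  simp [← Complex.ofReal_pow]

theorem one_add_le_mul_exp {κ r : ℝ} (hκ : 0 < κ) (hr : 0 ≤ r) :
    1 + r ≤ (1 + κ⁻¹) * Real.exp (κ * r) := by
  have h : κ * r + 1 ≤ Real.exp (κ * r) := Real.add_one_le_exp _
  have h2 : (1 + κ⁻¹) * (κ * r + 1) = 1 + r + κ * r + κ⁻¹ := by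
    field_simp
    ring
  have h3 : (1 + κ⁻¹) * (κ * r + 1) ≤ (1 + κ⁻¹) * Real.exp (κ * r) := by gcongr
  have : 0 ≤ κ * r := by positivity
  have : 0 < κ⁻¹ := by positivity
  linarith

theorem integrable_one_add_norm_sq_mul_exp {n : ℕ} {κ : ℝ} (hκ : 0 < κ) :
    Integrable (fun x : Euc n => (1 + ‖x‖ ^ 2) * Real.exp (-κ * ‖x‖ ^ 2)) := by
  refine ((integrable_exp_neg_mul_norm_sq (n := n) (half_pos hκ)).const_mul
    (1 + (κ / 2)⁻¹)).mono' (by fun_prop) (Filter.Eventually.of_forall fun x => ?_)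
  rw [Real.norm_of_nonneg (by positivity)]
  calc (1 + ‖x‖ ^ 2) * Real.exp (-κ * ‖x‖ ^ 2)
      ≤ ((1 + (κ / 2)⁻¹) * Real.exp (κ / 2 * ‖x‖ ^ 2)) * Real.exp (-κ * ‖x‖ ^ 2) := by
        gcongr
        exact one_add_le_mul_exp (half_pos hκ) (by positivity)
    _ = _ := by
        rw [mul_assoc, ← Real.exp_add]
        congr 2
        ring

theorem densityConv_integrand_integrable {n : ℕ} {u₀ φ : Euc n → ℝ} (hu : Integrable u₀)
    (hφ : Continuous φ) {C : ℝ} (hC : ∀ z, |φ z| ≤ C) (x : Euc n) :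
    Integrable (fun y => u₀ y * φ (x - y)) :=
  hu.mul_bdd (c := C) (by fun_prop) (Filter.Eventually.of_forall fun y => by simpa using hC _)

theorem hasFDerivAt_densityConv {n : ℕ} {u₀ φ : Euc n → ℝ} (hu : Integrable u₀)
    {φ' : Euc n → Euc n →L[ℝ] ℝ} (hφ : ∀ z, HasFDerivAt φ (φ' z) z)
    (hφ' : Continuous φ') {C C' : ℝ} (hC : ∀ z, |φ z| ≤ C) (hC' : ∀ z, ‖φ' z‖ ≤ C')
    (x : Euc n) :
    HasFDerivAt (densityConv u₀ φ) (∫ y, u₀ y • φ' (x - y)) x := by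
  have hφc : Continuous φ := continuous_iff_continuousAt.2 fun z => (hφ z).continuousAt
  refine hasFDerivAt_integral_of_dominated_of_fderiv_le (s := Set.univ)
    (F := fun x y => u₀ y * φ (x - y)) (F' := fun x y => u₀ y • φ' (x - y))
    (bound := fun y => ‖u₀ y‖ * C') Filter.univ_mem ?_ ?_ ?_ ?_ ?_ ?_
  · exact Filter.Eventually.of_forall fun x =>
      (densityConv_integrand_integrable hu hφc hC x).aestronglyMeasurable
  · exact densityConv_integrand_integrable hu hφc hC x
  · exact hu.aestronglyMeasurable.smul (by fun_prop : Continuous _).aestronglyMeasurable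
  · refine Filter.Eventually.of_forall fun y x _ => ?_
    rw [norm_smul]
    gcongr
    exact hC' _
  · exact hu.norm.mul_const _
  · refine Filter.Eventually.of_forall fun y x _ => ?_
    have h : HasFDerivAt (fun x => φ (x - y)) (φ' (x - y)) x := by
      have h' := (hφ (x - y)).comp x ((hasFDerivAt_id x).sub_const y)
      rwa [ContinuousLinearMap.comp_id] at h'
    exact h.const_mul _

theorem hasFDerivAt_densityConv_apply {n : ℕ} {u₀ : Euc n → ℝ} (hu : Integrable u₀)
    {φ' : Euc n → Euc n →L[ℝ] ℝ} (hφ' : Continuous φ') {C' : ℝ} (hC' : ∀ z, ‖φ' z‖ ≤ C')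
    (x v : Euc n) :
    (∫ y, u₀ y • φ' (x - y)) v = densityConv u₀ (fun z => φ' z v) x := by
  rw [ContinuousLinearMap.integral_apply]
  · rfl
  · exact hu.smul_bdd C' (by fun_prop : Continuous _).aestronglyMeasurable
      (Filter.Eventually.of_forall fun y => hC' _)

theorem integrable_mul_densityConv {n : ℕ} {u₀ ψ f : Euc n → ℝ} (hu : Integrable u₀)
    (hE : Integrable (fun x => ‖x‖ ^ 2 * u₀ x)) (hψ : Continuous ψ) {κ C D : ℝ} (hκ : 0 < κ)
    (hC : ∀ z, |ψ z| ≤ C * Real.exp (-κ * ‖z‖ ^ 2)) (hf : AEStronglyMeasurable f)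
    (hD : ∀ x, |f x| ≤ D * (1 + ‖x‖ ^ 2)) :
    Integrable (fun x => f x * densityConv u₀ ψ x) := by
  have hC0 : 0 ≤ C := by simpa using (abs_nonneg _).trans (hC 0)
  have hD0 : 0 ≤ D := by simpa using (abs_nonneg _).trans (hD 0)
  have hw : Integrable (fun y => (1 + ‖y‖ ^ 2) * |u₀ y|) := by
    refine (hu.abs.add hE.abs).congr (Filter.Eventually.of_forall fun y => ?_)
    simp [abs_mul]
    ring
  have hK : Integrable (fun z : Euc n => C * ((1 + ‖z‖ ^ 2) * Real.exp (-κ * ‖z‖ ^ 2))) :=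
    (integrable_one_add_norm_sq_mul_exp hκ).const_mul C
  have hψi : Integrable ψ := ((integrable_exp_neg_mul_norm_sq hκ).const_mul C).mono'
    hψ.aestronglyMeasurable (Filter.Eventually.of_forall hC)
  have hconv := hw.integrable_convolution (ContinuousLinearMap.mul ℝ ℝ) hK
  have hex := hw.ae_convolution_exists (ContinuousLinearMap.mul ℝ ℝ) hK
  have hm : AEStronglyMeasurable (densityConv u₀ ψ) :=
    (hu.integrable_convolution (ContinuousLinearMap.mul ℝ ℝ) hψi).aestronglyMeasurable
  refine (hconv.const_mul (D * 2)).mono' (hf.mul hm) ?_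
  filter_upwards [hex] with x hx
  have hx' : Integrable fun y => ((1 + ‖y‖ ^ 2) * |u₀ y|) *
    (C * ((1 + ‖x - y‖ ^ 2) * Real.exp (-κ * ‖x - y‖ ^ 2))) := hx
  have key : (1 + ‖x‖ ^ 2) * |densityConv u₀ ψ x| ≤ 2 * ∫ y, ((1 + ‖y‖ ^ 2) * |u₀ y|) *
      (C * ((1 + ‖x - y‖ ^ 2) * Real.exp (-κ * ‖x - y‖ ^ 2))) := by
    calc (1 + ‖x‖ ^ 2) * |densityConv u₀ ψ x|
        ≤ (1 + ‖x‖ ^ 2) * ∫ y, |u₀ y * ψ (x - y)| := by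
          gcongr
          exact abs_integral_le_integral_abs
      _ = ∫ y, (1 + ‖x‖ ^ 2) * |u₀ y * ψ (x - y)| := by rw [integral_const_mul]
      _ ≤ ∫ y, 2 * (((1 + ‖y‖ ^ 2) * |u₀ y|) *
            (C * ((1 + ‖x - y‖ ^ 2) * Real.exp (-κ * ‖x - y‖ ^ 2)))) := by
          refine integral_mono_of_nonneg (Filter.Eventually.of_forall fun y => by positivity)
            (hx'.const_mul 2) (Filter.Eventually.of_forall fun y => ?_)
          have h1 : 1 + ‖x‖ ^ 2 ≤ 2 * ((1 + ‖y‖ ^ 2) * (1 + ‖x - y‖ ^ 2)) := by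
            have h : ‖x‖ ≤ ‖y‖ + ‖x - y‖ := by simpa using norm_add_le y (x - y)
            have h' : ‖x‖ ^ 2 ≤ (‖y‖ + ‖x - y‖) ^ 2 := by gcongr
            nlinarith [sq_nonneg (‖y‖ - ‖x - y‖), mul_nonneg (sq_nonneg ‖y‖) (sq_nonneg ‖x - y‖)]
          calc (1 + ‖x‖ ^ 2) * |u₀ y * ψ (x - y)|
              ≤ (2 * ((1 + ‖y‖ ^ 2) * (1 + ‖x - y‖ ^ 2))) *
                (|u₀ y| * (C * Real.exp (-κ * ‖x - y‖ ^ 2))) := by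
                rw [abs_mul]
                gcongr
                exact hC _
            _ = _ := by ring
      _ = _ := by rw [integral_const_mul]
  calc ‖f x * densityConv u₀ ψ x‖ = |f x| * |densityConv u₀ ψ x| := by
        rw [Real.norm_eq_abs, abs_mul]
    _ ≤ (D * (1 + ‖x‖ ^ 2)) * |densityConv u₀ ψ x| := by
        gcongr
        exact hD x
    _ = D * ((1 + ‖x‖ ^ 2) * |densityConv u₀ ψ x|) := by ring
    _ ≤ D * (2 * ∫ y, ((1 + ‖y‖ ^ 2) * |u₀ y|) *
          (C * ((1 + ‖x - y‖ ^ 2) * Real.exp (-κ * ‖x - y‖ ^ 2)))) := by gcongr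
    _ = _ := by
        rw [← mul_assoc]
        rfl

theorem gaussianDensity_pos {n : ℕ} {σ : ℝ} (hσ : 0 < σ) (z : Euc n) :
    0 < gaussianDensity n σ z := by
  unfold gaussianDensity
  positivity

theorem continuous_gaussianDensity {n : ℕ} (σ : ℝ) : Continuous (gaussianDensity n σ) := by
  unfold gaussianDensity
  fun_prop

theorem hasFDerivAt_gaussianDensity {n : ℕ} {s : ℝ} (hs : 0 < s) (z : Euc n) :
    HasFDerivAt (gaussianDensity n (2 * s))
      ((-(2 * s)⁻¹ * gaussianDensity n (2 * s) z) • innerSL ℝ z) z := by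
  have h1 := (hasStrictFDerivAt_norm_sq z).hasFDerivAt
  have h2 := ((h1.const_mul (-(2 * (2 * s))⁻¹)).exp).const_mul
    ((2 * π * (2 * s)) ^ (-(n : ℝ) / 2))
  refine (h2.congr_of_eventuallyEq (Filter.Eventually.of_forall fun x => ?_)).congr_fderiv ?_
  · simp only [gaussianDensity]
    congr 2
    ring
  · ext v
    simp only [gaussianDensity, FunLike.coe_smul, Pi.smul_apply, smul_eq_mul,
      nsmul_eq_mul]
    rw [show -‖z‖ ^ 2 / (2 * (2 * s)) = -(2 * (2 * s))⁻¹ * ‖z‖ ^ 2 by ring]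
    field_simp
    norm_num

theorem hasDerivAt_gaussianDensity_time {n : ℕ} {s : ℝ} (hs : 0 < s) (z : Euc n) :
    HasDerivAt (fun s => gaussianDensity n (2 * s) z)
      ((‖z‖ ^ 2 / (4 * s ^ 2) - n / (2 * s)) * gaussianDensity n (2 * s) z) s := by
  have h1 : HasDerivAt (fun s : ℝ => 2 * π * (2 * s)) (2 * π * (2 * 1)) s :=
    ((hasDerivAt_id s).const_mul 2).const_mul (2 * π)
  have hp : 0 < 2 * π * (2 * s) := by positivity
  have h2 := h1.rpow_const (p := -(n : ℝ) / 2) (Or.inl hp.ne')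
  have h3 : HasDerivAt (fun s : ℝ => -‖z‖ ^ 2 / (2 * (2 * s))) (‖z‖ ^ 2 / (4 * s ^ 2)) s := by
    have := ((((hasDerivAt_id s).const_mul 2).const_mul 2).inv (by simp; positivity)).const_mul
      (-‖z‖ ^ 2)
    refine (this.congr_of_eventuallyEq (Filter.Eventually.of_forall fun x => ?_)).congr_deriv ?_
    · simp [div_eq_mul_inv]
    · simp
      field_simp
      ring
  refine (h2.mul h3.exp).congr_deriv ?_
  unfold gaussianDensity
  rw [Real.rpow_sub_one hp.ne']
  field_simp
  ring

theorem exists_gaussianDensity_bound (n : ℕ) {a b : ℝ} (ha : 0 < a) (hab : a ≤ b) :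
    ∃ C : ℝ, ∀ s ∈ Set.Icc a b, ∀ z : Euc n,
      (1 + ‖z‖ ^ 2) * gaussianDensity n (2 * s) z ≤ C * Real.exp (-(8 * b)⁻¹ * ‖z‖ ^ 2) := by
  have hb : 0 < b := ha.trans_le hab
  refine ⟨(1 + ((8 * b)⁻¹)⁻¹) * (2 * π * (2 * a)) ^ (-(n : ℝ) / 2), fun s hs z => ?_⟩
  have hs0 : 0 < s := ha.trans_le hs.1
  have hn : -(n : ℝ) / 2 ≤ 0 := by
    have : (0 : ℝ) ≤ n := n.cast_nonneg
    linarith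
  have h1 : gaussianDensity n (2 * s) z ≤
      (2 * π * (2 * a)) ^ (-(n : ℝ) / 2) * Real.exp (-(4 * b)⁻¹ * ‖z‖ ^ 2) := by
    unfold gaussianDensity
    gcongr ?_ * ?_
    · exact Real.rpow_le_rpow_of_nonpos (by positivity) (by gcongr; exact hs.1) hn
    · rw [Real.exp_le_exp, neg_div, neg_mul, neg_le_neg_iff]
      have h4 : 2 * (2 * s) ≤ 4 * b := by linarith [hs.2]
      rw [div_eq_inv_mul]
      gcongr
  calc (1 + ‖z‖ ^ 2) * gaussianDensity n (2 * s) z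
      ≤ ((1 + ((8 * b)⁻¹)⁻¹) * Real.exp ((8 * b)⁻¹ * ‖z‖ ^ 2)) *
        ((2 * π * (2 * a)) ^ (-(n : ℝ) / 2) * Real.exp (-(4 * b)⁻¹ * ‖z‖ ^ 2)) := by
        gcongr ?_ * ?_
        · exact (gaussianDensity_pos (by positivity) z).le
        · exact one_add_le_mul_exp (by positivity) (by positivity)
    _ = _ := by
        rw [show -(8 * b)⁻¹ * ‖z‖ ^ 2 = (8 * b)⁻¹ * ‖z‖ ^ 2 + -(4 * b)⁻¹ * ‖z‖ ^ 2 by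
          field_simp; ring, Real.exp_add]
        ring

/-- The `i`-th partial derivative of the heat kernel at time `s`. -/
def heatKernelDeriv (n : ℕ) (s : ℝ) (i : Fin n) : Euc n → ℝ :=
  fun z => (-(2 * s)⁻¹ * z i) * gaussianDensity n (2 * s) z

/-- The second partial derivative of the heat kernel at time `s` in the `i`-th direction. -/
def heatKernelDeriv₂ (n : ℕ) (s : ℝ) (i : Fin n) : Euc n → ℝ :=
  fun z => (z i ^ 2 / (4 * s ^ 2) - 1 / (2 * s)) * gaussianDensity n (2 * s) z

/-- The time derivative of the heat kernel at time `s`. -/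
def heatKernelTimeDeriv (n : ℕ) (s : ℝ) : Euc n → ℝ :=
  fun z => (‖z‖ ^ 2 / (4 * s ^ 2) - n / (2 * s)) * gaussianDensity n (2 * s) z

theorem continuous_heatKernelDeriv {n : ℕ} (s : ℝ) (i : Fin n) :
    Continuous (heatKernelDeriv n s i) := by
  have := continuous_gaussianDensity (n := n) (2 * s)
  unfold heatKernelDeriv
  fun_prop

theorem continuous_heatKernelDeriv₂ {n : ℕ} (s : ℝ) (i : Fin n) :
    Continuous (heatKernelDeriv₂ n s i) := by
  have := continuous_gaussianDensity (n := n) (2 * s)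
  unfold heatKernelDeriv₂
  fun_prop

theorem continuous_heatKernelTimeDeriv {n : ℕ} (s : ℝ) :
    Continuous (heatKernelTimeDeriv n s) := by
  have := continuous_gaussianDensity (n := n) (2 * s)
  unfold heatKernelTimeDeriv
  fun_prop

theorem abs_coord_le_one_add {n : ℕ} (z : Euc n) (i : Fin n) : |z i| ≤ 1 + ‖z‖ ^ 2 := by
  have h := PiLp.norm_apply_le z i
  rw [Real.norm_eq_abs] at h
  nlinarith [sq_nonneg (‖z‖ - 1), norm_nonneg z]

theorem coord_sq_le {n : ℕ} (z : Euc n) (i : Fin n) : z i ^ 2 ≤ ‖z‖ ^ 2 := by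
  have h := PiLp.norm_apply_le z i
  rw [Real.norm_eq_abs] at h
  exact sq_le_sq' (by linarith [neg_abs_le (z i)]) ((le_abs_self _).trans h)

theorem abs_heatKernelDeriv_le {n : ℕ} {s : ℝ} (hs : 0 < s) (i : Fin n) (z : Euc n) :
    |heatKernelDeriv n s i z| ≤
      (2 * s)⁻¹ * ((1 + ‖z‖ ^ 2) * gaussianDensity n (2 * s) z) := by
  have hG := gaussianDensity_pos (n := n) (σ := 2 * s) (by positivity) z
  have h2 : (0 : ℝ) < (2 * s)⁻¹ := by positivity
  rw [heatKernelDeriv, abs_mul, abs_mul, abs_neg, abs_of_pos hG, abs_of_pos h2, mul_assoc]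
  gcongr
  exact abs_coord_le_one_add z i

theorem abs_heatKernelDeriv₂_le {n : ℕ} {s : ℝ} (hs : 0 < s) (i : Fin n) (z : Euc n) :
    |heatKernelDeriv₂ n s i z| ≤
      (1 / (4 * s ^ 2) + 1 / (2 * s)) * ((1 + ‖z‖ ^ 2) * gaussianDensity n (2 * s) z) := by
  have hG := gaussianDensity_pos (n := n) (σ := 2 * s) (by positivity) z
  rw [heatKernelDeriv₂, abs_mul, abs_of_pos hG, ← mul_assoc]
  gcongr
  have h1 : |z i ^ 2 / (4 * s ^ 2)| = z i ^ 2 * (1 / (4 * s ^ 2)) := by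
    rw [abs_of_nonneg (by positivity)]; ring
  have h2 : |1 / (2 * s)| = 1 / (2 * s) := abs_of_pos (by positivity)
  have h3 := abs_sub (z i ^ 2 / (4 * s ^ 2)) (1 / (2 * s))
  have h4 : z i ^ 2 * (1 / (4 * s ^ 2)) ≤ ‖z‖ ^ 2 * (1 / (4 * s ^ 2)) := by
    gcongr ?_ * _
    exact coord_sq_le z i
  have h5 : 0 ≤ ‖z‖ ^ 2 * (1 / (2 * s)) := by positivity
  have h6 : 0 ≤ 1 / (4 * s ^ 2) := by positivity
  nlinarith

theorem abs_heatKernelTimeDeriv_le {n : ℕ} {a s : ℝ} (ha : 0 < a) (has : a ≤ s) (z : Euc n) :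
    |heatKernelTimeDeriv n s z| ≤
      (1 / (4 * a ^ 2) + n / (2 * a)) * ((1 + ‖z‖ ^ 2) * gaussianDensity n (2 * s) z) := by
  have hs : 0 < s := ha.trans_le has
  have hG := gaussianDensity_pos (n := n) (σ := 2 * s) (by positivity) z
  rw [heatKernelTimeDeriv, abs_mul, abs_of_pos hG, ← mul_assoc]
  gcongr
  have h1 : |‖z‖ ^ 2 / (4 * s ^ 2)| = ‖z‖ ^ 2 * (1 / (4 * s ^ 2)) := by
    rw [abs_of_nonneg (by positivity)]; ring
  have h2 : |(n : ℝ) / (2 * s)| = n / (2 * s) := abs_of_nonneg (by positivity)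
  have h3 := abs_sub (‖z‖ ^ 2 / (4 * s ^ 2)) (n / (2 * s))
  have h4 : ‖z‖ ^ 2 * (1 / (4 * s ^ 2)) ≤ ‖z‖ ^ 2 * (1 / (4 * a ^ 2)) := by gcongr
  have h7 : (n : ℝ) / (2 * s) ≤ n / (2 * a) := by gcongr
  have h5 : 0 ≤ ‖z‖ ^ 2 * (n / (2 * a)) := by positivity
  have h6 : 0 ≤ 1 / (4 * a ^ 2) := by positivity
  nlinarith

theorem exists_gaussianDensity_le (n : ℕ) {s : ℝ} (hs : 0 < s) :
    ∃ C : ℝ, ∀ z : Euc n, (1 + ‖z‖ ^ 2) * gaussianDensity n (2 * s) z ≤ C := by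
  obtain ⟨C, hC⟩ := exists_gaussianDensity_bound n hs le_rfl
  have hC0 : 0 ≤ C := by
    have h := hC s ⟨le_rfl, le_rfl⟩ 0
    have := gaussianDensity_pos (n := n) (σ := 2 * s) (by positivity) 0
    simp at h
    linarith
  refine ⟨C, fun z => (hC s ⟨le_rfl, le_rfl⟩ z).trans ?_⟩
  refine mul_le_of_le_one_right hC0 (Real.exp_le_one_iff.2 ?_)
  rw [neg_mul, neg_nonpos]
  positivity

theorem exists_abs_le_of_le_gaussianDensity {n : ℕ} {s : ℝ} (hs : 0 < s) {ψ : Euc n → ℝ} {K : ℝ}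
    (hK : 0 ≤ K) (hψ : ∀ z, |ψ z| ≤ K * ((1 + ‖z‖ ^ 2) * gaussianDensity n (2 * s) z)) :
    ∃ C, ∀ z, |ψ z| ≤ C := by
  obtain ⟨C, hC⟩ := exists_gaussianDensity_le n hs
  exact ⟨K * C, fun z => (hψ z).trans (by gcongr; exact hC z)⟩

theorem densityConv_integrand_integrable_of_le {n : ℕ} {u₀ : Euc n → ℝ} (hu : Integrable u₀)
    {s : ℝ} (hs : 0 < s) {ψ : Euc n → ℝ} (hψc : Continuous ψ) {K : ℝ} (hK : 0 ≤ K)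
    (hψ : ∀ z, |ψ z| ≤ K * ((1 + ‖z‖ ^ 2) * gaussianDensity n (2 * s) z)) (x : Euc n) :
    Integrable (fun y => u₀ y * ψ (x - y)) := by
  obtain ⟨C, hC⟩ := exists_abs_le_of_le_gaussianDensity hs hK hψ
  exact densityConv_integrand_integrable hu hψc hC x

theorem integrable_mul_densityConv_of_le {n : ℕ} {u₀ ψ f : Euc n → ℝ} (hu : Integrable u₀)
    (hE : Integrable (fun x => ‖x‖ ^ 2 * u₀ x)) {s : ℝ} (hs : 0 < s) (hψc : Continuous ψ)
    {K D : ℝ} (hK : 0 ≤ K)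
    (hψ : ∀ z, |ψ z| ≤ K * ((1 + ‖z‖ ^ 2) * gaussianDensity n (2 * s) z))
    (hf : AEStronglyMeasurable f) (hD : ∀ x, |f x| ≤ D * (1 + ‖x‖ ^ 2)) :
    Integrable (fun x => f x * densityConv u₀ ψ x) := by
  obtain ⟨C, hC⟩ := exists_gaussianDensity_bound n hs le_rfl
  refine integrable_mul_densityConv hu hE hψc (κ := (8 * s)⁻¹) (C := K * C) (by positivity)
    (fun z => (hψ z).trans ?_) hf hD
  rw [mul_assoc]
  exact mul_le_mul_of_nonneg_left (hC s ⟨le_rfl, le_rfl⟩ z) hK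

theorem gaussianDensity_le_one_add_mul {n : ℕ} {s : ℝ} (hs : 0 < s) (z : Euc n) :
    |gaussianDensity n (2 * s) z| ≤ 1 * ((1 + ‖z‖ ^ 2) * gaussianDensity n (2 * s) z) := by
  have hG := gaussianDensity_pos (n := n) (σ := 2 * s) (by positivity) z
  rw [abs_of_pos hG, one_mul]
  exact le_mul_of_one_le_left hG.le (by linarith [sq_nonneg ‖z‖])

theorem exists_hasFDerivAt_heatSol {n : ℕ} {u₀ : Euc n → ℝ} (hu : Integrable u₀) {s : ℝ}
    (hs : 0 < s) (x : Euc n) :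
    ∃ L : Euc n →L[ℝ] ℝ, HasFDerivAt (heatSol u₀ s) L x ∧
      ∀ i, L (EuclideanSpace.single i 1) = densityConv u₀ (heatKernelDeriv n s i) x := by
  obtain ⟨C, hC⟩ := exists_gaussianDensity_le n hs
  have hG : ∀ z : Euc n, 0 < gaussianDensity n (2 * s) z :=
    gaussianDensity_pos (by positivity)
  have hGc := continuous_gaussianDensity (n := n) (2 * s)
  have hφ'c : Continuous fun z : Euc n =>
      (-(2 * s)⁻¹ * gaussianDensity n (2 * s) z) • innerSL ℝ z := by fun_prop
  have hφ' : ∀ z : Euc n,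
      ‖(-(2 * s)⁻¹ * gaussianDensity n (2 * s) z) • innerSL ℝ z‖ ≤ (2 * s)⁻¹ * C := by
    intro z
    have h2 : (0 : ℝ) < (2 * s)⁻¹ := by positivity
    rw [norm_smul, norm_mul, norm_neg, Real.norm_of_nonneg h2.le, Real.norm_of_nonneg (hG z).le,
      innerSL_apply_norm, mul_assoc]
    gcongr
    refine le_trans ?_ (hC z)
    rw [mul_comm]
    gcongr
    · exact (hG z).le
    · nlinarith [sq_nonneg (‖z‖ - 1), norm_nonneg z]
  obtain ⟨C₀, hC₀⟩ := exists_abs_le_of_le_gaussianDensity hs zero_le_one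
    (gaussianDensity_le_one_add_mul (n := n) hs)
  refine ⟨_, hasFDerivAt_densityConv hu (hasFDerivAt_gaussianDensity hs) hφ'c hC₀ hφ' x,
    fun i => ?_⟩
  rw [hasFDerivAt_densityConv_apply hu hφ'c hφ']
  congr 1
  ext z
  simp [heatKernelDeriv, EuclideanSpace.inner_single_right]
  ring

theorem exists_hasFDerivAt_densityConv_heatKernelDeriv {n : ℕ} {u₀ : Euc n → ℝ}
    (hu : Integrable u₀) {s : ℝ} (hs : 0 < s) (i : Fin n) (x : Euc n) :
    ∃ L : Euc n →L[ℝ] ℝ, HasFDerivAt (densityConv u₀ (heatKernelDeriv n s i)) L x ∧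
      L (EuclideanSpace.single i 1) = densityConv u₀ (heatKernelDeriv₂ n s i) x := by
  obtain ⟨C, hC⟩ := exists_gaussianDensity_le n hs
  have hG : ∀ z : Euc n, 0 < gaussianDensity n (2 * s) z :=
    gaussianDensity_pos (by positivity)
  have hGc := continuous_gaussianDensity (n := n) (2 * s)
  have h2 : (0 : ℝ) < (2 * s)⁻¹ := by positivity
  let p : Euc n →L[ℝ] ℝ := EuclideanSpace.proj i
  let φ' : Euc n → Euc n →L[ℝ] ℝ := fun z =>
    (-(2 * s)⁻¹ * z i) • ((-(2 * s)⁻¹ * gaussianDensity n (2 * s) z) • innerSL ℝ z) +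
      gaussianDensity n (2 * s) z • (-(2 * s)⁻¹ • p)
  have hφ'c : Continuous φ' := by fun_prop
  have hφd : ∀ z, HasFDerivAt (heatKernelDeriv n s i) (φ' z) z := fun z =>
    ((p.hasFDerivAt (x := z)).const_mul (-(2 * s)⁻¹)).mul (hasFDerivAt_gaussianDensity hs z)
  have hφ' : ∀ z, ‖φ' z‖ ≤ (2 * s)⁻¹ * (2 * s)⁻¹ * C + (2 * s)⁻¹ * ‖p‖ * C := by
    intro z
    refine (norm_add_le _ _).trans (add_le_add ?_ ?_)
    · rw [norm_smul, norm_smul, norm_mul, norm_mul, norm_neg, Real.norm_of_nonneg h2.le,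
        Real.norm_of_nonneg (hG z).le, innerSL_apply_norm]
      calc (2 * s)⁻¹ * ‖z i‖ * ((2 * s)⁻¹ * gaussianDensity n (2 * s) z * ‖z‖)
          ≤ (2 * s)⁻¹ * ‖z‖ * ((2 * s)⁻¹ * gaussianDensity n (2 * s) z * ‖z‖) := by
            have := (hG z).le
            gcongr
            exact PiLp.norm_apply_le z i
        _ = (2 * s)⁻¹ * (2 * s)⁻¹ * (‖z‖ ^ 2 * gaussianDensity n (2 * s) z) := by ring
        _ ≤ _ := by
            gcongr
            linarith [hC z, hG z]
    · rw [norm_smul, norm_smul, norm_neg, Real.norm_of_nonneg h2.le,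
        Real.norm_of_nonneg (hG z).le, mul_comm]
      gcongr
      have : 0 ≤ ‖z‖ ^ 2 * gaussianDensity n (2 * s) z := mul_nonneg (sq_nonneg _) (hG z).le
      linarith [hC z]
  obtain ⟨C₀, hC₀⟩ := exists_abs_le_of_le_gaussianDensity hs h2.le
    (abs_heatKernelDeriv_le (n := n) hs i)
  refine ⟨_, hasFDerivAt_densityConv hu hφd hφ'c hC₀ hφ' x, ?_⟩
  rw [hasFDerivAt_densityConv_apply hu hφ'c hφ']
  congr 1
  ext z
  simp [heatKernelDeriv₂, φ', p, EuclideanSpace.inner_single_right]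
  field_simp
  ring

theorem hasDerivAt_heatSol_time {n : ℕ} {u₀ : Euc n → ℝ} (hu : Integrable u₀) {s : ℝ}
    (hs : 0 < s) (x : Euc n) :
    HasDerivAt (fun s => heatSol u₀ s x) (densityConv u₀ (heatKernelTimeDeriv n s) x) s := by
  have ha : 0 < s / 2 := by positivity
  have hab : s / 2 ≤ 2 * s := by linarith
  obtain ⟨C, hC⟩ := exists_gaussianDensity_bound n ha hab
  have hC0 : 0 ≤ C := by
    have h := hC s ⟨by linarith, by linarith⟩ 0
    have := gaussianDensity_pos (n := n) (σ := 2 * s) (by positivity) 0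
    simp at h
    linarith
  let K : ℝ := 1 / (4 * (s / 2) ^ 2) + n / (2 * (s / 2))
  have hK : 0 ≤ K := by positivity
  refine (hasDerivAt_integral_of_dominated_loc_of_deriv_le (s := Set.Icc (s / 2) (2 * s))
    (F := fun s y => u₀ y * gaussianDensity n (2 * s) (x - y))
    (F' := fun s y => u₀ y * heatKernelTimeDeriv n s (x - y))
    (bound := fun y => |u₀ y| * (K * C)) (Icc_mem_nhds (by linarith) (by linarith))
    ?_ ?_ ?_ ?_ ?_ ?_).2
  · refine Filter.Eventually.of_forall fun r => hu.aestronglyMeasurable.mul ?_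
    have := continuous_gaussianDensity (n := n) (2 * r)
    exact (by fun_prop : Continuous _).aestronglyMeasurable
  · exact densityConv_integrand_integrable_of_le hu hs (continuous_gaussianDensity _) zero_le_one
      (gaussianDensity_le_one_add_mul hs) x
  · refine hu.aestronglyMeasurable.mul ?_
    have := continuous_heatKernelTimeDeriv (n := n) s
    exact (by fun_prop : Continuous _).aestronglyMeasurable
  · refine Filter.Eventually.of_forall fun y r hr => ?_
    rw [Real.norm_eq_abs, abs_mul]
    gcongr
    refine (abs_heatKernelTimeDeriv_le ha hr.1 _).trans ?_
    refine mul_le_mul_of_nonneg_left ((hC r hr _).trans ?_) hK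
    refine mul_le_of_le_one_right hC0 (Real.exp_le_one_iff.2 ?_)
    rw [neg_mul, neg_nonpos]
    positivity
  · exact hu.abs.mul_const _
  · refine Filter.Eventually.of_forall fun y r hr => ?_
    exact (hasDerivAt_gaussianDensity_time (ha.trans_le hr.1) _).const_mul _

theorem abs_sq_coord_mul_gaussianDensity_le {n : ℕ} {s : ℝ} (hs : 0 < s) (i : Fin n)
    (z : Euc n) :
    |z i ^ 2 / (4 * s ^ 2) * gaussianDensity n (2 * s) z| ≤
      1 / (4 * s ^ 2) * ((1 + ‖z‖ ^ 2) * gaussianDensity n (2 * s) z) := by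
  have hG := gaussianDensity_pos (n := n) (σ := 2 * s) (by positivity) z
  rw [abs_of_nonneg (by positivity), ← mul_assoc, div_eq_mul_one_div, mul_comm (z i ^ 2)]
  gcongr
  linarith [coord_sq_le z i]

theorem IsProbDensity.integrable {n : ℕ} {u₀ : Euc n → ℝ} (hu₀ : IsProbDensity u₀) :
    Integrable u₀ := by
  by_contra h
  have := hu₀.2.2
  rw [integral_undef h] at this
  exact zero_ne_one this

theorem IsProbDensity.integral_mul_exp_pos {n : ℕ} {u₀ : Euc n → ℝ} (hu₀ : IsProbDensity u₀)
    {κ : ℝ} (hκ : 0 ≤ κ) : 0 < ∫ y, u₀ y * Real.exp (-κ * ‖y‖ ^ 2) := by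
  have hu := hu₀.integrable
  have hi : Integrable fun y => u₀ y * Real.exp (-κ * ‖y‖ ^ 2) := by
    refine hu.mul_bdd (c := 1) (by fun_prop) (Filter.Eventually.of_forall fun y => ?_)
    rw [Real.norm_of_nonneg (Real.exp_pos _).le, Real.exp_le_one_iff, neg_mul, neg_nonpos]
    positivity
  rw [integral_pos_iff_support_of_nonneg
    (fun y => mul_nonneg (hu₀.2.1 y) (Real.exp_pos _).le) hi]
  have h : 0 < ∫ y, u₀ y := by rw [hu₀.2.2]; exact zero_lt_one
  rw [integral_pos_iff_support_of_nonneg hu₀.2.1 hu] at h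
  convert h using 2
  ext y
  simp [Real.exp_ne_zero]

theorem exists_heatSol_lower_bound {n : ℕ} {u₀ : Euc n → ℝ} (hu₀ : IsProbDensity u₀) {a b : ℝ}
    (ha : 0 < a) (hab : a ≤ b) :
    ∃ c > 0, ∀ s ∈ Set.Icc a b, ∀ x,
      c * Real.exp (-(2 * a)⁻¹ * ‖x‖ ^ 2) ≤ heatSol u₀ s x := by
  have hb : 0 < b := ha.trans_le hab
  have hu := hu₀.integrable
  have hpos := hu₀.integral_mul_exp_pos (κ := (2 * a)⁻¹) (by positivity)
  refine ⟨(2 * π * (2 * b)) ^ (-(n : ℝ) / 2) * ∫ y, u₀ y * Real.exp (-(2 * a)⁻¹ * ‖y‖ ^ 2),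
    by positivity, fun s hs x => ?_⟩
  have hs0 : 0 < s := ha.trans_le hs.1
  have hn : -(n : ℝ) / 2 ≤ 0 := by
    have : (0 : ℝ) ≤ n := n.cast_nonneg
    linarith
  have hi := densityConv_integrand_integrable_of_le hu hs0 (continuous_gaussianDensity _)
    zero_le_one (gaussianDensity_le_one_add_mul (n := n) hs0) x
  rw [mul_right_comm, ← integral_const_mul]
  refine integral_mono_of_nonneg (Filter.Eventually.of_forall fun y => ?_) hi
    (Filter.Eventually.of_forall fun y => ?_)
  · have := hu₀.2.1 y
    simp only [Pi.zero_apply]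
    positivity
  · have h1 : (2 * π * (2 * b)) ^ (-(n : ℝ) / 2) ≤ (2 * π * (2 * s)) ^ (-(n : ℝ) / 2) :=
      Real.rpow_le_rpow_of_nonpos (by positivity) (by gcongr; exact hs.2) hn
    have h2 : Real.exp (-(2 * a)⁻¹ * ‖x‖ ^ 2) * Real.exp (-(2 * a)⁻¹ * ‖y‖ ^ 2) ≤
        Real.exp (-‖x - y‖ ^ 2 / (2 * (2 * s))) := by
      rw [← Real.exp_add, Real.exp_le_exp, neg_div, neg_mul, neg_mul, ← neg_add, neg_le_neg_iff]
      have h3 : ‖x - y‖ ^ 2 ≤ 2 * (‖x‖ ^ 2 + ‖y‖ ^ 2) := by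
        have h : ‖x - y‖ ^ 2 ≤ (‖x‖ + ‖y‖) ^ 2 := by
          gcongr
          exact norm_sub_le x y
        nlinarith [sq_nonneg (‖x‖ - ‖y‖)]
      calc ‖x - y‖ ^ 2 / (2 * (2 * s)) ≤ (2 * (‖x‖ ^ 2 + ‖y‖ ^ 2)) / (2 * (2 * a)) := by
            gcongr
            exact hs.1
        _ = _ := by field_simp
    calc (2 * π * (2 * b)) ^ (-(n : ℝ) / 2) * Real.exp (-(2 * a)⁻¹ * ‖x‖ ^ 2) *
          (u₀ y * Real.exp (-(2 * a)⁻¹ * ‖y‖ ^ 2))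
        = u₀ y * ((2 * π * (2 * b)) ^ (-(n : ℝ) / 2) * (Real.exp (-(2 * a)⁻¹ * ‖x‖ ^ 2) *
          Real.exp (-(2 * a)⁻¹ * ‖y‖ ^ 2))) := by ring
      _ ≤ u₀ y * gaussianDensity n (2 * s) (x - y) := by
          have := hu₀.2.1 y
          unfold gaussianDensity
          gcongr

theorem heatSol_pos {n : ℕ} {u₀ : Euc n → ℝ} (hu₀ : IsProbDensity u₀) {s : ℝ} (hs : 0 < s)
    (x : Euc n) : 0 < heatSol u₀ s x := by
  obtain ⟨c, hc, h⟩ := exists_heatSol_lower_bound hu₀ hs le_rfl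
  exact (by positivity : 0 < c * _).trans_le (h s ⟨le_rfl, le_rfl⟩ x)

theorem exists_heatSol_upper_bound {n : ℕ} {u₀ : Euc n → ℝ} (hu₀ : IsProbDensity u₀) {a b : ℝ}
    (ha : 0 < a) (hab : a ≤ b) :
    ∃ c, ∀ s ∈ Set.Icc a b, ∀ x, heatSol u₀ s x ≤ c := by
  obtain ⟨C, hC⟩ := exists_gaussianDensity_bound n ha hab
  have hb : 0 < b := ha.trans_le hab
  have hu := hu₀.integrable
  have hC0 : 0 ≤ C := by
    have h := hC a ⟨le_rfl, hab⟩ 0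
    have := gaussianDensity_pos (n := n) (σ := 2 * a) (by positivity) 0
    simp at h
    linarith
  refine ⟨∫ y, u₀ y * C, fun s hs x => ?_⟩
  have hs0 : 0 < s := ha.trans_le hs.1
  have hG : ∀ z : Euc n, 0 < gaussianDensity n (2 * s) z :=
    gaussianDensity_pos (by positivity)
  refine integral_mono_of_nonneg
    (Filter.Eventually.of_forall fun y => mul_nonneg (hu₀.2.1 y) (hG _).le) (hu.mul_const C)
    (Filter.Eventually.of_forall fun y => mul_le_mul_of_nonneg_left ?_ (hu₀.2.1 y))
  have h1 : C * Real.exp (-(8 * b)⁻¹ * ‖x - y‖ ^ 2) ≤ C := by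
    refine mul_le_of_le_one_right hC0 (Real.exp_le_one_iff.2 ?_)
    rw [neg_mul, neg_nonpos]
    positivity
  have h2 := gaussianDensity_le_one_add_mul hs0 (x - y)
  rw [one_mul, abs_of_pos (hG _)] at h2
  exact h2.trans ((hC s hs _).trans h1)

theorem exists_abs_log_heatSol_le {n : ℕ} {u₀ : Euc n → ℝ} (hu₀ : IsProbDensity u₀) {a b : ℝ}
    (ha : 0 < a) (hab : a ≤ b) :
    ∃ D, ∀ s ∈ Set.Icc a b, ∀ x, |Real.log (heatSol u₀ s x)| ≤ D * (1 + ‖x‖ ^ 2) := by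
  obtain ⟨c, hc, hl⟩ := exists_heatSol_lower_bound hu₀ ha hab
  obtain ⟨C, hC⟩ := exists_heatSol_upper_bound hu₀ ha hab
  refine ⟨|Real.log c| + |Real.log C| + (2 * a)⁻¹, fun s hs x => ?_⟩
  have hpos := heatSol_pos hu₀ (ha.trans_le hs.1) x
  have h1 : Real.log (heatSol u₀ s x) ≤ Real.log C := Real.log_le_log hpos (hC s hs x)
  have h2 := Real.log_le_log (by positivity) (hl s hs x)
  rw [Real.log_mul hc.ne' (Real.exp_ne_zero _), Real.log_exp] at h2
  have ha' : 0 < (2 * a)⁻¹ := by positivity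
  have hx := sq_nonneg ‖x‖
  have h3 := mul_nonneg (abs_nonneg (Real.log c)) hx
  have h4 := mul_nonneg (abs_nonneg (Real.log C)) hx
  have h5 := mul_nonneg ha'.le hx
  rw [abs_le]
  constructor
  · nlinarith [neg_abs_le (Real.log c), abs_nonneg (Real.log C)]
  · nlinarith [le_abs_self (Real.log C), abs_nonneg (Real.log c)]

theorem abs_densityConv_le {n : ℕ} {u₀ ψ Ψ : Euc n → ℝ} (h0 : ∀ x, 0 ≤ u₀ x) (x : Euc n)
    (hi : Integrable fun y => u₀ y * Ψ (x - y)) (h : ∀ z, |ψ z| ≤ Ψ z) :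
    |densityConv u₀ ψ x| ≤ densityConv u₀ Ψ x := by
  refine norm_integral_le_of_norm_le (f := fun y => u₀ y * ψ (x - y)) hi
    (Filter.Eventually.of_forall fun y => ?_)
  rw [Real.norm_eq_abs, abs_mul, abs_of_nonneg (h0 y)]
  exact mul_le_mul_of_nonneg_left (h _) (h0 y)

theorem continuous_heatSol {n : ℕ} {u₀ : Euc n → ℝ} (hu : Integrable u₀) {s : ℝ} (hs : 0 < s) :
    Continuous (heatSol u₀ s) :=
  continuous_iff_continuousAt.2 fun x =>
    (exists_hasFDerivAt_heatSol hu hs x).choose_spec.1.continuousAt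

theorem continuous_log_heatSol {n : ℕ} {u₀ : Euc n → ℝ} (hu₀ : IsProbDensity u₀) {s : ℝ}
    (hs : 0 < s) : Continuous fun x => Real.log (heatSol u₀ s x) :=
  (continuous_heatSol hu₀.integrable hs).log fun x => (heatSol_pos hu₀ hs x).ne'

theorem continuous_densityConv_heatKernelDeriv {n : ℕ} {u₀ : Euc n → ℝ} (hu : Integrable u₀)
    {s : ℝ} (hs : 0 < s) (i : Fin n) : Continuous (densityConv u₀ (heatKernelDeriv n s i)) :=
  continuous_iff_continuousAt.2 fun x =>
    (exists_hasFDerivAt_densityConv_heatKernelDeriv hu hs i x).choose_spec.1.continuousAt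

theorem hasDerivAt_integral_heatSol_mul_log {n : ℕ} {u₀ : Euc n → ℝ} (hu₀ : IsProbDensity u₀)
    (hE : Integrable (fun x => ‖x‖ ^ 2 * u₀ x)) {t : ℝ} (ht : 0 < t) :
    HasDerivAt (fun s => ∫ x, heatSol u₀ s x * Real.log (heatSol u₀ s x))
      (∫ x, (Real.log (heatSol u₀ t x) + 1) * densityConv u₀ (heatKernelTimeDeriv n t) x) t := by
  have hu := hu₀.integrable
  have ha : 0 < t / 2 := by positivity
  have hab : t / 2 ≤ 2 * t := by linarith
  obtain ⟨C, hC⟩ := exists_gaussianDensity_bound n ha hab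
  obtain ⟨D, hD⟩ := exists_abs_log_heatSol_le hu₀ ha hab
  have htI : t ∈ Set.Icc (t / 2) (2 * t) := ⟨by linarith, by linarith⟩
  let K : ℝ := 1 / (4 * (t / 2) ^ 2) + n / (2 * (t / 2))
  have hK : 0 ≤ K := by positivity
  let Ψ : Euc n → ℝ := fun z => K * C * Real.exp (-(8 * (2 * t))⁻¹ * ‖z‖ ^ 2)
  have hΨc : Continuous Ψ := by fun_prop
  have hΨ : ∀ r ∈ Set.Icc (t / 2) (2 * t), ∀ z, |heatKernelTimeDeriv n r z| ≤ Ψ z := by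
    intro r hr z
    refine (abs_heatKernelTimeDeriv_le ha hr.1 z).trans ?_
    simp only [Ψ, mul_assoc K]
    exact mul_le_mul_of_nonneg_left (hC r hr z) hK
  have hΨ0 : ∀ z, 0 ≤ Ψ z := fun z => (abs_nonneg _).trans (hΨ t htI z)
  have hKC : 0 ≤ K * C := by simpa [Ψ] using hΨ0 0
  have hΨle : ∀ z, |Ψ z| ≤ K * C := by
    intro z
    rw [abs_of_nonneg (hΨ0 z)]
    refine mul_le_of_le_one_right hKC (Real.exp_le_one_iff.2 ?_)
    rw [neg_mul, neg_nonpos]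
    positivity
  have hD1 : ∀ r ∈ Set.Icc (t / 2) (2 * t), ∀ x,
      |Real.log (heatSol u₀ r x) + 1| ≤ (D + 1) * (1 + ‖x‖ ^ 2) := by
    intro r hr x
    have h1 := abs_add_le (Real.log (heatSol u₀ r x)) 1
    rw [abs_one] at h1
    linarith [hD r hr x, sq_nonneg ‖x‖]
  refine (hasDerivAt_integral_of_dominated_loc_of_deriv_le (s := Set.Icc (t / 2) (2 * t))
    (F := fun s x => heatSol u₀ s x * Real.log (heatSol u₀ s x))
    (F' := fun s x => (Real.log (heatSol u₀ s x) + 1) *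
      densityConv u₀ (heatKernelTimeDeriv n s) x)
    (bound := fun x => ((D + 1) * (1 + ‖x‖ ^ 2)) * densityConv u₀ Ψ x)
    (Icc_mem_nhds (by linarith) (by linarith)) ?_ ?_ ?_ ?_ ?_ ?_).2
  · filter_upwards [lt_mem_nhds ht] with s hs
    exact ((continuous_heatSol hu hs).mul (continuous_log_heatSol hu₀ hs)).aestronglyMeasurable
  · refine (integrable_mul_densityConv_of_le hu hE ht (continuous_gaussianDensity (2 * t))
      zero_le_one (gaussianDensity_le_one_add_mul ht)
      (continuous_log_heatSol hu₀ ht).aestronglyMeasurable (hD t htI)).congr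
      (Filter.Eventually.of_forall fun x => mul_comm _ _)
  · exact (integrable_mul_densityConv_of_le hu hE ht (continuous_heatKernelTimeDeriv t)
      hK (abs_heatKernelTimeDeriv_le ha htI.1)
      ((continuous_log_heatSol hu₀ ht).add continuous_const).aestronglyMeasurable
      (hD1 t htI)).aestronglyMeasurable
  · refine Filter.Eventually.of_forall fun x r hr => ?_
    rw [Real.norm_eq_abs, abs_mul]
    exact mul_le_mul (hD1 r hr x)
      (abs_densityConv_le hu₀.2.1 x (densityConv_integrand_integrable hu hΨc hΨle x) (hΨ r hr))
      (abs_nonneg _) ((abs_nonneg _).trans (hD1 r hr x))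
  · refine integrable_mul_densityConv (κ := (8 * (2 * t))⁻¹) (C := K * C) (D := |D + 1|) hu hE hΨc
      (by positivity) (fun z => (abs_of_nonneg (hΨ0 z)).le) (by fun_prop) fun x => ?_
    rw [abs_mul, abs_of_nonneg (by positivity : 0 ≤ 1 + ‖x‖ ^ 2)]
  · refine Filter.Eventually.of_forall fun x r hr => ?_
    have hr0 : 0 < r := ha.trans_le hr.1
    exact (Real.hasDerivAt_mul_log (heatSol_pos hu₀ hr0 x).ne').comp r
      (hasDerivAt_heatSol_time hu hr0 x)

theorem sq_densityConv_heatKernelDeriv_le {n : ℕ} {u₀ : Euc n → ℝ} (hu₀ : IsProbDensity u₀)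
    {s : ℝ} (hs : 0 < s) (i : Fin n) (x : Euc n) :
    densityConv u₀ (heatKernelDeriv n s i) x ^ 2 / heatSol u₀ s x ≤
      densityConv u₀ (fun z => z i ^ 2 / (4 * s ^ 2) * gaussianDensity n (2 * s) z) x := by
  have hu := hu₀.integrable
  have hGc := continuous_gaussianDensity (n := n) (2 * s)
  have hG : ∀ z : Euc n, 0 < gaussianDensity n (2 * s) z :=
    gaussianDensity_pos (by positivity)
  have h1 := densityConv_integrand_integrable_of_le hu hs hGc
    zero_le_one (gaussianDensity_le_one_add_mul hs) x
  have h2 := densityConv_integrand_integrable_of_le hu hs (continuous_heatKernelDeriv s i)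
    (by positivity) (abs_heatKernelDeriv_le hs i) x
  have h3 := densityConv_integrand_integrable_of_le hu hs
    (ψ := fun z => z i ^ 2 / (4 * s ^ 2) * gaussianDensity n (2 * s) z) (by fun_prop)
    (by positivity) (abs_sq_coord_mul_gaussianDensity_le hs i) x
  have hpos := heatSol_pos hu₀ hs x
  set l : ℝ := -densityConv u₀ (heatKernelDeriv n s i) x / heatSol u₀ s x with hl
  have key : 0 ≤ l ^ 2 * heatSol u₀ s x + 2 * l * densityConv u₀ (heatKernelDeriv n s i) x +
      densityConv u₀ (fun z => z i ^ 2 / (4 * s ^ 2) * gaussianDensity n (2 * s) z) x := by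
    have h12 : Integrable fun y => l ^ 2 * (u₀ y * gaussianDensity n (2 * s) (x - y)) +
        2 * l * (u₀ y * heatKernelDeriv n s i (x - y)) := (h1.const_mul _).add (h2.const_mul _)
    unfold densityConv heatSol
    beta_reduce
    rw [← integral_const_mul, ← integral_const_mul,
      ← integral_add (h1.const_mul _) (h2.const_mul _), ← integral_add h12 h3]
    refine integral_nonneg fun y => ?_
    have e : l ^ 2 * (u₀ y * gaussianDensity n (2 * s) (x - y)) +
        2 * l * (u₀ y * heatKernelDeriv n s i (x - y)) +
        u₀ y * ((x - y) i ^ 2 / (4 * s ^ 2) * gaussianDensity n (2 * s) (x - y)) =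
        u₀ y * gaussianDensity n (2 * s) (x - y) * (l - (2 * s)⁻¹ * (x - y) i) ^ 2 := by
      unfold heatKernelDeriv
      field_simp
      ring
    simp only [Pi.zero_apply]
    rw [e]
    exact mul_nonneg (mul_nonneg (hu₀.2.1 y) (hG _).le) (sq_nonneg _)
  have e2 : l ^ 2 * heatSol u₀ s x + 2 * l * densityConv u₀ (heatKernelDeriv n s i) x =
      -(densityConv u₀ (heatKernelDeriv n s i) x ^ 2 / heatSol u₀ s x) := by
    rw [hl]
    field_simp
    ring
  linarith

theorem integrable_sq_densityConv_heatKernelDeriv_div {n : ℕ} {u₀ : Euc n → ℝ}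
    (hu₀ : IsProbDensity u₀) (hE : Integrable (fun x => ‖x‖ ^ 2 * u₀ x)) {s : ℝ} (hs : 0 < s)
    (i : Fin n) :
    Integrable fun x => densityConv u₀ (heatKernelDeriv n s i) x ^ 2 / heatSol u₀ s x := by
  have hu := hu₀.integrable
  have hGc := continuous_gaussianDensity (n := n) (2 * s)
  have h := integrable_mul_densityConv_of_le hu hE hs
    (ψ := fun z => z i ^ 2 / (4 * s ^ 2) * gaussianDensity n (2 * s) z) (f := fun _ => 1)
    (by fun_prop) (by positivity) (abs_sq_coord_mul_gaussianDensity_le hs i) (D := 1)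
    (by fun_prop) (fun x => by rw [abs_one]; linarith [sq_nonneg ‖x‖])
  refine h.mono' (((continuous_densityConv_heatKernelDeriv hu hs i).pow 2).div
    (continuous_heatSol hu hs) fun x => (heatSol_pos hu₀ hs x).ne').aestronglyMeasurable
    (Filter.Eventually.of_forall fun x => ?_)
  have := heatSol_pos hu₀ hs x
  rw [Real.norm_of_nonneg (by positivity), one_mul]
  exact sq_densityConv_heatKernelDeriv_le hu₀ hs i x

theorem integral_log_mul_densityConv_heatKernelDeriv₂ {n : ℕ} {u₀ : Euc n → ℝ}
    (hu₀ : IsProbDensity u₀) (hE : Integrable (fun x => ‖x‖ ^ 2 * u₀ x)) {s : ℝ} (hs : 0 < s)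
    (i : Fin n) :
    Integrable (fun x =>
      (Real.log (heatSol u₀ s x) + 1) * densityConv u₀ (heatKernelDeriv₂ n s i) x) ∧
    ∫ x, (Real.log (heatSol u₀ s x) + 1) * densityConv u₀ (heatKernelDeriv₂ n s i) x =
      -∫ x, densityConv u₀ (heatKernelDeriv n s i) x ^ 2 / heatSol u₀ s x := by
  have hu := hu₀.integrable
  obtain ⟨D, hD⟩ := exists_abs_log_heatSol_le hu₀ hs le_rfl
  have hD1 : ∀ x, |Real.log (heatSol u₀ s x) + 1| ≤ (D + 1) * (1 + ‖x‖ ^ 2) := by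
    intro x
    have h1 := abs_add_le (Real.log (heatSol u₀ s x)) 1
    rw [abs_one] at h1
    linarith [hD s ⟨le_rfl, le_rfl⟩ x, sq_nonneg ‖x‖]
  have hlc := ((continuous_log_heatSol hu₀ hs).add
    (continuous_const (y := (1 : ℝ)))).aestronglyMeasurable (μ := volume)
  have hfg' := integrable_mul_densityConv_of_le hu hE hs (continuous_heatKernelDeriv₂ s i)
    (by positivity) (abs_heatKernelDeriv₂_le hs i) hlc hD1
  have hfg := integrable_mul_densityConv_of_le hu hE hs (continuous_heatKernelDeriv s i)
    (by positivity) (abs_heatKernelDeriv_le hs i) hlc hD1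
  have he : ∀ x, (heatSol u₀ s x)⁻¹ * densityConv u₀ (heatKernelDeriv n s i) x *
      densityConv u₀ (heatKernelDeriv n s i) x =
      densityConv u₀ (heatKernelDeriv n s i) x ^ 2 / heatSol u₀ s x := fun x => by ring
  refine ⟨hfg', ?_⟩
  have := integral_bilinear_hasLineDerivAt_right_eq_neg_left_of_integrable (μ := volume)
    (B := ContinuousLinearMap.mul ℝ ℝ) (v := EuclideanSpace.single i (1 : ℝ))
    (f := fun x => Real.log (heatSol u₀ s x) + 1)
    (f' := fun x => (heatSol u₀ s x)⁻¹ * densityConv u₀ (heatKernelDeriv n s i) x)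
    (g := densityConv u₀ (heatKernelDeriv n s i))
    (g' := densityConv u₀ (heatKernelDeriv₂ n s i))
    ((integrable_sq_densityConv_heatKernelDeriv_div hu₀ hE hs i).congr
      (Filter.Eventually.of_forall fun x => (he x).symm)) hfg' hfg ?_ ?_
  · simpa only [ContinuousLinearMap.mul_apply', he] using this
  · intro x _
    obtain ⟨L, hL, hLi⟩ := exists_hasFDerivAt_heatSol hu hs x
    rw [← hLi i]
    exact ((hL.log (heatSol_pos hu₀ hs x).ne').add_const 1).hasLineDerivAt _
  · intro x _
    obtain ⟨L, hL, hLi⟩ := exists_hasFDerivAt_densityConv_heatKernelDeriv hu hs i x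
    rw [← hLi]
    exact hL.hasLineDerivAt _

theorem densityConv_heatKernelTimeDeriv_eq_sum {n : ℕ} {u₀ : Euc n → ℝ} (hu : Integrable u₀)
    {s : ℝ} (hs : 0 < s) (x : Euc n) :
    densityConv u₀ (heatKernelTimeDeriv n s) x =
      ∑ i, densityConv u₀ (heatKernelDeriv₂ n s i) x := by
  unfold densityConv
  rw [← integral_finsetSum _ fun i _ => densityConv_integrand_integrable_of_le hu hs
    (continuous_heatKernelDeriv₂ s i) (by positivity) (abs_heatKernelDeriv₂_le hs i) x]
  congr 1
  ext y
  rw [← Finset.mul_sum]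
  congr 1
  simp only [heatKernelTimeDeriv, heatKernelDeriv₂]
  rw [← Finset.sum_mul, Finset.sum_sub_distrib, ← Finset.sum_div, EuclideanSpace.real_norm_sq_eq]
  congr 2
  simp
  ring

theorem norm_sq_gradient_heatSol {n : ℕ} {u₀ : Euc n → ℝ} (hu : Integrable u₀)
    {s : ℝ} (hs : 0 < s) (x : Euc n) :
    ‖gradient (heatSol u₀ s) x‖ ^ 2 = ∑ i, densityConv u₀ (heatKernelDeriv n s i) x ^ 2 := by
  obtain ⟨L, hL, hLi⟩ := exists_hasFDerivAt_heatSol hu hs x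
  rw [EuclideanSpace.real_norm_sq_eq, hL.hasGradientAt.gradient]
  refine Finset.sum_congr rfl fun i _ => ?_
  rw [← hLi i, ← InnerProductSpace.toDual_symm_apply (𝕜 := ℝ) (x := EuclideanSpace.single i 1)
    (y := L), EuclideanSpace.inner_single_right]
  simp

theorem fisherInfo_heatSol {n : ℕ} {u₀ : Euc n → ℝ} (hu₀ : IsProbDensity u₀)
    (hE : Integrable (fun x => ‖x‖ ^ 2 * u₀ x)) {s : ℝ} (hs : 0 < s) :
    fisherInfo (heatSol u₀ s) =
      ∑ i, ∫ x, densityConv u₀ (heatKernelDeriv n s i) x ^ 2 / heatSol u₀ s x := by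
  have h : {x | 0 < heatSol u₀ s x} = Set.univ := Set.eq_univ_of_forall (heatSol_pos hu₀ hs)
  rw [fisherInfo, h, Measure.restrict_univ, ← integral_finsetSum _ fun i _ =>
    integrable_sq_densityConv_heatKernelDeriv_div hu₀ hE hs i]
  simp only [norm_sq_gradient_heatSol hu₀.integrable hs, Finset.sum_div]

/-- **DeBruijn's identity.** If `u₀` is a probability density on `ℝⁿ` with finite
second moment and `u(·,t) = u₀ * M_{2t}` solves the heat equation, then for every
`t > 0`, `d/dt H(u(·,t)) = I(u(·,t))`. -/
theorem deBruijn_identity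
    {n : ℕ} (u₀ : Euc n → ℝ) (hu₀ : IsProbDensity u₀)
    (hE : Integrable (fun x => ‖x‖ ^ 2 * u₀ x)) :
    ∀ t : ℝ, 0 < t →
      HasDerivAt (fun s => shannonEntropy (heatSol u₀ s)) (fisherInfo (heatSol u₀ t)) t := by
  intro t ht
  refine (hasDerivAt_integral_heatSol_mul_log hu₀ hE ht).neg.congr_deriv ?_
  simp only [densityConv_heatKernelTimeDeriv_eq_sum hu₀.integrable ht, Finset.mul_sum]
  rw [integral_finsetSum _ fun i _ =>
    (integral_log_mul_densityConv_heatKernelDeriv₂ hu₀ hE ht i).1, fisherInfo_heatSol hu₀ hE ht,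
    ← Finset.sum_neg_distrib]
  refine Finset.sum_congr rfl fun i _ => ?_
  rw [(integral_log_mul_densityConv_heatKernelDeriv₂ hu₀ hE ht i).2, neg_neg]
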